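/- Let 0 < γ < 1, let f : ℝ^q → ℝ be any function, let c_1,…,c_M > 0, and let A_1,…,A_M be subsets of {1,…,q}. Define F(b) = f(b) + λ Σ_{j=1}^M c_j ‖b_{A_j}‖₁^γ and G(b, θ) = f(b) + Σ_{j=1}^M θ_j^(1-1/γ) c_j^(1/γ) ‖b_{A_j}‖₁ + τ Σ_{j=1}^M θ_j for θ_j ≥ 0, where λ = τ^(1-γ) γ^(-γ) (1-γ)^(γ-1). Then b* minimizes F over ℝ^q if and only if there exists θ* ≥ 0 such that (b*, θ*) minimizes G over ℝ^q × [0,∞)^M. -/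

import Mathlib

open Real Finset

/-- The `j`-th term of the auxiliary objective: `θ^(1-1/γ) c^(1/γ) s` with the
convention that it is `0` when `θ = 0, s = 0` and `+∞` when `θ = 0, s > 0`. -/
noncomputable def gbTerm (γ c θ s : ℝ) : EReal :=
  if θ = 0 then (if s = 0 then (0 : EReal) else ⊤)
  else ((θ ^ (1 - 1 / γ) * c ^ (1 / γ) * s : ℝ) : EReal)

/-- The multiplier `λ` for which the group bridge penalty is the partial minimum of the auxiliary
objective over `θ`. -/
noncomputable def bridgeMultiplier (γ τ : ℝ) : ℝ :=
  τ ^ (1 - γ) * γ ^ (-γ) * (1 - γ) ^ (γ - 1)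

/-- The value of `θ` minimizing `θ^(1-1/γ) c^(1/γ) s + τ θ`. -/
noncomputable def bridgeMinimizer (γ τ c s : ℝ) : ℝ :=
  c * s ^ γ * ((1 - γ) / (γ * τ)) ^ γ

section

variable {γ τ c s θ : ℝ}

lemma bridgeMinimizer_nonneg (hγ0 : 0 < γ) (hγ1 : γ < 1) (hτ : 0 < τ) (hc : 0 < c)
    (hs : 0 ≤ s) : 0 ≤ bridgeMinimizer γ τ c s := by
  have : 0 < 1 - γ := sub_pos.2 hγ1
  unfold bridgeMinimizer
  positivity

lemma bridge_le_rpow_mul_add (hγ0 : 0 < γ) (hγ1 : γ < 1) (hτ : 0 < τ) (hc : 0 < c)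
    (hs : 0 ≤ s) (hθ : 0 < θ) :
    bridgeMultiplier γ τ * (c * s ^ γ) ≤ θ ^ (1 - 1 / γ) * c ^ (1 / γ) * s + τ * θ := by
  have hγ : 0 < 1 - γ := sub_pos.2 hγ1
  have h := Real.geom_mean_le_arith_mean2_weighted hγ0.le hγ.le
    (p₁ := θ ^ (1 - 1 / γ) * c ^ (1 / γ) * s / γ) (p₂ := τ * θ / (1 - γ))
    (by positivity) (by positivity) (by ring)
  have e₁ : (θ ^ (1 - 1 / γ) * c ^ (1 / γ) * s / γ) ^ γ = θ ^ (γ - 1) * c * s ^ γ * γ ^ (-γ) := by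
    rw [div_rpow (by positivity) hγ0.le, mul_rpow (by positivity) hs,
      mul_rpow (by positivity) (by positivity), ← rpow_mul hθ.le, ← rpow_mul hc.le,
      one_div_mul_cancel hγ0.ne', rpow_one, rpow_neg hγ0.le, div_eq_mul_inv, sub_mul,
      one_div_mul_cancel hγ0.ne', one_mul]
  have e₂ : (τ * θ / (1 - γ)) ^ (1 - γ) = τ ^ (1 - γ) * θ ^ (1 - γ) * (1 - γ) ^ (γ - 1) := by
    rw [div_rpow (by positivity) hγ.le, mul_rpow hτ.le hθ.le, div_eq_mul_inv, ← rpow_neg hγ.le,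
      neg_sub]
  have e₃ : θ ^ (γ - 1) * θ ^ (1 - γ) = 1 := by
    rw [← rpow_add hθ, sub_add_sub_cancel, sub_self, rpow_zero]
  rw [e₁, e₂, mul_div_cancel₀ _ hγ0.ne', mul_div_cancel₀ _ hγ.ne'] at h
  calc _ = θ ^ (γ - 1) * θ ^ (1 - γ) * (bridgeMultiplier γ τ * (c * s ^ γ)) := by
        rw [e₃, one_mul]
    _ = _ := by unfold bridgeMultiplier; ring
    _ ≤ _ := h

lemma rpow_mul_add_bridgeMinimizer (hγ0 : 0 < γ) (hγ1 : γ < 1) (hτ : 0 < τ) (hc : 0 < c)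
    (hs : 0 < s) :
    bridgeMinimizer γ τ c s ^ (1 - 1 / γ) * c ^ (1 / γ) * s + τ * bridgeMinimizer γ τ c s =
      bridgeMultiplier γ τ * (c * s ^ γ) := by
  have hγ : 0 < 1 - γ := sub_pos.2 hγ1
  have hpos : 0 < bridgeMinimizer γ τ c s := by unfold bridgeMinimizer; positivity
  have e₁ : bridgeMinimizer γ τ c s ^ (1 / γ) = c ^ (1 / γ) * s * ((1 - γ) / (γ * τ)) := by
    unfold bridgeMinimizer
    rw [mul_rpow (by positivity) (by positivity), mul_rpow hc.le (by positivity),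
      ← rpow_mul hs.le, ← rpow_mul (by positivity), mul_one_div_cancel hγ0.ne', rpow_one, rpow_one]
  have e₂ : bridgeMinimizer γ τ c s * τ / (1 - γ) = bridgeMultiplier γ τ * (c * s ^ γ) := by
    unfold bridgeMinimizer bridgeMultiplier
    rw [div_rpow hγ.le (by positivity), mul_rpow hγ0.le hτ.le, rpow_sub hτ, rpow_neg hγ0.le,
      rpow_sub hγ, rpow_one, rpow_one]
    field_simp
  have hcpos : 0 < c ^ (1 / γ) := by positivity
  rw [← e₂, rpow_sub hpos, rpow_one, e₁]
  field_simp
  ring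

lemma bridge_le_gbTerm_add (hγ0 : 0 < γ) (hγ1 : γ < 1) (hτ : 0 < τ) (hc : 0 < c)
    (hs : 0 ≤ s) (hθ : 0 ≤ θ) :
    ((bridgeMultiplier γ τ * (c * s ^ γ) : ℝ) : EReal) ≤
      gbTerm γ c θ s + ((τ * θ : ℝ) : EReal) := by
  unfold gbTerm
  split_ifs with h₀ h₁
  · simp [h₀, h₁, zero_rpow hγ0.ne']
  · rw [EReal.top_add_coe]
    exact le_top
  · rw [← EReal.coe_add, EReal.coe_le_coe_iff]
    exact bridge_le_rpow_mul_add hγ0 hγ1 hτ hc hs (hθ.lt_of_ne' h₀)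

lemma gbTerm_bridgeMinimizer_add (hγ0 : 0 < γ) (hγ1 : γ < 1) (hτ : 0 < τ) (hc : 0 < c)
    (hs : 0 ≤ s) :
    gbTerm γ c (bridgeMinimizer γ τ c s) s + ((τ * bridgeMinimizer γ τ c s : ℝ) : EReal) =
      ((bridgeMultiplier γ τ * (c * s ^ γ) : ℝ) : EReal) := by
  rcases hs.eq_or_lt with rfl | hs
  · simp [gbTerm, bridgeMinimizer, zero_rpow hγ0.ne']
  · have hγ : 0 < 1 - γ := sub_pos.2 hγ1
    have hpos : 0 < bridgeMinimizer γ τ c s := by unfold bridgeMinimizer; positivity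
    rw [gbTerm, if_neg hpos.ne', ← EReal.coe_add,
      rpow_mul_add_bridgeMinimizer hγ0 hγ1 hτ hc hs]

end

lemma EReal.coe_finset_sum {ι : Type*} (t : Finset ι) (g : ι → ℝ) :
    ((∑ i ∈ t, g i : ℝ) : EReal) = ∑ i ∈ t, (g i : EReal) :=
  map_sum (⟨⟨Real.toEReal, EReal.coe_zero⟩, EReal.coe_add⟩ : ℝ →+ EReal) g t

lemma add_sum_gbTerm_add {M : ℕ} (γ τ r : ℝ) (c θ s : Fin M → ℝ) :
    (r : EReal) + ∑ j, gbTerm γ (c j) (θ j) (s j) + ((τ * ∑ j, θ j : ℝ) : EReal) =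
      (r : EReal) + ∑ j, (gbTerm γ (c j) (θ j) (s j) + ((τ * θ j : ℝ) : EReal)) := by
  rw [mul_sum, EReal.coe_finset_sum, sum_add_distrib, add_assoc]

lemma coe_add_mul_sum {M : ℕ} (l r : ℝ) (p : Fin M → ℝ) :
    ((r + l * ∑ j, p j : ℝ) : EReal) = (r : EReal) + ∑ j, ((l * p j : ℝ) : EReal) := by
  rw [EReal.coe_add, mul_sum, EReal.coe_finset_sum]

/-- Proposition 1 of Huang et al. (2009): `b*` minimizes the group bridge objective
`F(b) = f(b) + λ Σ_j c_j ‖b_{A_j}‖₁^γ` iff there is `θ* ≥ 0` such that `(b*, θ*)`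
minimizes `G(b,θ) = f(b) + Σ_j θ_j^(1-1/γ) c_j^(1/γ) ‖b_{A_j}‖₁ + τ Σ_j θ_j` over
`ℝ^q × [0,∞)^M`, where `λ = τ^(1-γ) γ^(-γ) (1-γ)^(γ-1)`. -/
theorem stmt_1 (q M : ℕ) (γ τ : ℝ) (hγ0 : 0 < γ) (hγ1 : γ < 1) (hτ : 0 < τ)
    (f : (Fin q → ℝ) → ℝ) (c : Fin M → ℝ) (hc : ∀ j, 0 < c j)
    (A : Fin M → Finset (Fin q))
    (lam : ℝ) (hlam : lam = τ ^ (1 - γ) * γ ^ (-γ) * (1 - γ) ^ (γ - 1))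
    (bstar : Fin q → ℝ) :
    (∀ b : Fin q → ℝ,
        f bstar + lam * ∑ j, c j * (∑ k ∈ A j, |bstar k|) ^ γ ≤
          f b + lam * ∑ j, c j * (∑ k ∈ A j, |b k|) ^ γ) ↔
      ∃ θstar : Fin M → ℝ, (∀ j, 0 ≤ θstar j) ∧
        ∀ (b : Fin q → ℝ) (θ : Fin M → ℝ), (∀ j, 0 ≤ θ j) →
          ((f bstar : ℝ) : EReal) + ∑ j, gbTerm γ (c j) (θstar j) (∑ k ∈ A j, |bstar k|)
              + ((τ * ∑ j, θstar j : ℝ) : EReal) ≤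
            ((f b : ℝ) : EReal) + ∑ j, gbTerm γ (c j) (θ j) (∑ k ∈ A j, |b k|)
              + ((τ * ∑ j, θ j : ℝ) : EReal) := by
  have hs : ∀ (b : Fin q → ℝ) (j : Fin M), 0 ≤ ∑ k ∈ A j, |b k| :=
    fun b j => sum_nonneg fun k _ => abs_nonneg (b k)
  have hlam' : lam = bridgeMultiplier γ τ := hlam
  have le_aux : ∀ (b : Fin q → ℝ) (θ : Fin M → ℝ), (∀ j, 0 ≤ θ j) →
      ((f b + lam * ∑ j, c j * (∑ k ∈ A j, |b k|) ^ γ : ℝ) : EReal) ≤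
        ((f b : ℝ) : EReal) + ∑ j, gbTerm γ (c j) (θ j) (∑ k ∈ A j, |b k|)
          + ((τ * ∑ j, θ j : ℝ) : EReal) := by
    intro b θ hθ
    rw [add_sum_gbTerm_add, coe_add_mul_sum, hlam']
    gcongr with j
    exact bridge_le_gbTerm_add hγ0 hγ1 hτ (hc j) (hs b j) (hθ j)
  have aux_eq : ∀ b : Fin q → ℝ,
      ((f b : ℝ) : EReal)
          + ∑ j, gbTerm γ (c j) (bridgeMinimizer γ τ (c j) (∑ k ∈ A j, |b k|)) (∑ k ∈ A j, |b k|)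
          + ((τ * ∑ j, bridgeMinimizer γ τ (c j) (∑ k ∈ A j, |b k|) : ℝ) : EReal) =
        ((f b + lam * ∑ j, c j * (∑ k ∈ A j, |b k|) ^ γ : ℝ) : EReal) := by
    intro b
    rw [add_sum_gbTerm_add, coe_add_mul_sum, hlam']
    congr 1
    exact sum_congr rfl fun j _ => gbTerm_bridgeMinimizer_add hγ0 hγ1 hτ (hc j) (hs b j)
  have nonneg : ∀ (b : Fin q → ℝ) (j : Fin M),
      0 ≤ bridgeMinimizer γ τ (c j) (∑ k ∈ A j, |b k|) :=
    fun b j => bridgeMinimizer_nonneg hγ0 hγ1 hτ (hc j) (hs b j)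
  constructor
  · intro h
    refine ⟨fun j => bridgeMinimizer γ τ (c j) (∑ k ∈ A j, |bstar k|), nonneg bstar, ?_⟩
    intro b θ hθ
    rw [aux_eq]
    exact (EReal.coe_le_coe_iff.2 (h b)).trans (le_aux b θ hθ)
  · rintro ⟨θstar, hθ, h⟩ b
    rw [← EReal.coe_le_coe_iff, ← aux_eq b]
    exact (le_aux bstar θstar hθ).trans (h b _ (nonneg b))
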